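/- arXiv:cond-mat/0108432 — 2 statements merged into one kernel-verified Lean document; each statement's English description precedes it below -/
import Mathlib

section
/- (One-magnon spectrum for general spin s, Eq. (5.1)) Fix an integer d ≥ 1 and set s = d/2. Let H_s be the spin-s Heisenberg Hamiltonian on G. Then: (i) the fully polarized basis state e_{μ⁰} with μ⁰(u) = d for all u is an eigenvector of H_s with eigenvalue L·s² = (1/2)·N·j·s²; (ii) for every x ∈ ℂ^V with Adj(G)·x = λ·x, the one-magnon state ψ = Σ_{n ∈ V} x(n)·e_{μ_n}, where μ_n(n) = d−1 and μ_n(u) = d for u ≠ n, satisfies H_s ψ = ((1/2)·N·j·s² + (λ − j)·s)·ψ. Hence the eigenvalues of H_s on the one-magnon sector are exactly (1/2)·N·j·s² + (λ − j)·s with λ an eigenvalue of Adj(G). -/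
open Matrix BigOperators

/-- Spin-`s` configurations (`s = d/2`): each site carries `μ(u) ∈ {0,…,d}`,
with magnetic quantum number `m_u = μ(u) − s`. -/
abbrev SConf (V : Type*) (d : ℕ) := V → Fin (d + 1)

variable {V : Type*}

/-- The spin quantum number `s = d/2`. -/
noncomputable def sval (d : ℕ) : ℝ := (d : ℝ) / 2

/-- The magnetic quantum number `m = x − s`. -/
noncomputable def mval (d : ℕ) (x : Fin (d + 1)) : ℝ := (x : ℝ) - (d : ℝ) / 2

/-- The single-site operator `S_z(u)`. -/
noncomputable def Sz [Fintype V] [DecidableEq V] (d : ℕ) (u : V) :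
    Matrix (SConf V d) (SConf V d) ℂ :=
  Matrix.diagonal fun μ => (mval d (μ u) : ℂ)

/-- The single-site raising operator `S_+(u)`, with matrix element
`√(s(s+1) − m(m+1))` (which vanishes automatically when `μ(u) = d`). -/
noncomputable def Sp [Fintype V] [DecidableEq V] (d : ℕ) (u : V) :
    Matrix (SConf V d) (SConf V d) ℂ :=
  Matrix.of fun ν μ =>
    if ν = Function.update μ u ⟨min ((μ u : ℕ) + 1) d, by omega⟩ then
      ((Real.sqrt (sval d * (sval d + 1) - mval d (μ u) * (mval d (μ u) + 1)) : ℝ) : ℂ)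
    else 0

/-- The single-site lowering operator `S_−(u)`, with matrix element
`√(s(s+1) − m(m−1))` (which vanishes automatically when `μ(u) = 0`). -/
noncomputable def Sm [Fintype V] [DecidableEq V] (d : ℕ) (u : V) :
    Matrix (SConf V d) (SConf V d) ℂ :=
  Matrix.of fun ν μ =>
    if ν = Function.update μ u ⟨(μ u : ℕ) - 1, by have := (μ u).isLt; omega⟩ then
      ((Real.sqrt (sval d * (sval d + 1) - mval d (μ u) * (mval d (μ u) - 1)) : ℝ) : ℂ)
    else 0

/-- The spin-`s` Heisenberg Hamiltonian
`H_s = Σ_{{u,v} ∈ E(G)} [S_z(u)S_z(v) + (1/2)(S_+(u)S_−(v) + S_−(u)S_+(v))]`,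
written as `(1/2)·Σ` over ordered adjacent pairs. -/
noncomputable def Hs [Fintype V] [DecidableEq V] (G : SimpleGraph V) [DecidableRel G.Adj]
    (d : ℕ) : Matrix (SConf V d) (SConf V d) ℂ :=
  (1/2 : ℂ) • ∑ u : V, ∑ v ∈ G.neighborFinset u,
    (Sz d u * Sz d v + (1/2 : ℂ) • (Sp d u * Sm d v + Sm d u * Sp d v))

/-- The fully polarized configuration `μ⁰`. -/
def fullUp (V : Type*) (d : ℕ) : SConf V d := fun _ => Fin.last d

/-- The configuration `μ_n` with `μ_n(n) = d − 1` and `μ_n(u) = d` otherwise. -/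
def oneDown [DecidableEq V] (d : ℕ) (n : V) : SConf V d :=
  Function.update (fullUp V d) n ⟨d - 1, by omega⟩

/-- `√(s(s+1) − m(m+1))` at the magnetic quantum number `m` of the level `x`. -/
noncomputable abbrev raiseCoeff (d : ℕ) (x : Fin (d + 1)) : ℝ :=
  Real.sqrt (sval d * (sval d + 1) - mval d x * (mval d x + 1))

/-- `√(s(s+1) − m(m−1))` at the magnetic quantum number `m` of the level `x`. -/
noncomputable abbrev lowerCoeff (d : ℕ) (x : Fin (d + 1)) : ℝ :=
  Real.sqrt (sval d * (sval d + 1) - mval d x * (mval d x - 1))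

lemma mval_last (d : ℕ) : mval d (Fin.last d) = sval d := by
  simp only [mval, sval, Fin.val_last]; ring

lemma mval_pred {d : ℕ} (hd : 1 ≤ d) (h : d - 1 < d + 1) : mval d ⟨d - 1, h⟩ = sval d - 1 := by
  simp only [mval, sval, Nat.cast_sub hd]; push_cast; ring

lemma raiseCoeff_last (d : ℕ) : raiseCoeff d (Fin.last d) = 0 := by
  simp [raiseCoeff, mval_last]

lemma raiseCoeff_pred {d : ℕ} (hd : 1 ≤ d) (h : d - 1 < d + 1) :
    raiseCoeff d ⟨d - 1, h⟩ = Real.sqrt d := by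
  rw [raiseCoeff, mval_pred hd, sval]; congr 1; ring

lemma lowerCoeff_last (d : ℕ) : lowerCoeff d (Fin.last d) = Real.sqrt d := by
  rw [lowerCoeff, mval_last, sval]; congr 1; ring

lemma sqrt_cast_mul_self (d : ℕ) : ((Real.sqrt d : ℝ) : ℂ) * ((Real.sqrt d : ℝ) : ℂ) = d := by
  rw [← Complex.ofReal_mul, Real.mul_self_sqrt (Nat.cast_nonneg d), Complex.ofReal_natCast]

lemma sum_smul_sum_neighborFinset [Fintype V] {M : Type*} [AddCommGroup M] [Module ℂ M]
    (G : SimpleGraph V) [DecidableRel G.Adj] (x : V → ℂ) (f : V → M) :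
    ∑ n, x n • ∑ v ∈ G.neighborFinset n, f v = ∑ v, (G.adjMatrix ℂ *ᵥ x) v • f v := by
  simp only [SimpleGraph.adjMatrix_mulVec_apply, Finset.smul_sum, Finset.sum_smul]
  exact Finset.sum_comm' (by simp [G.adj_comm])

section OneDown

variable [DecidableEq V]

lemma oneDown_self (d : ℕ) (n : V) : oneDown d n n = ⟨d - 1, by omega⟩ := by
  simp [oneDown]

lemma oneDown_of_ne (d : ℕ) {n u : V} (h : u ≠ n) : oneDown d n u = Fin.last d := by
  simp [oneDown, fullUp, h]

lemma oneDown_injective {d : ℕ} (hd : 1 ≤ d) :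
    Function.Injective (oneDown d : V → SConf V d) := by
  intro m n h
  by_contra hmn
  have := congrArg Fin.val (congrFun h m)
  rw [oneDown_self, oneDown_of_ne d hmn, Fin.val_last] at this
  simp only at this
  omega

lemma update_oneDown_self (d : ℕ) (n : V) :
    Function.update (oneDown d n) n (Fin.last d) = fullUp V d := by
  ext u
  by_cases h : u = n
  · subst h; simp [fullUp]
  · simp [h, oneDown_of_ne, fullUp]

lemma mval_oneDown {d : ℕ} (hd : 1 ≤ d) (n u : V) :
    mval d (oneDown d n u) = sval d - if u = n then 1 else 0 := by
  split_ifs with h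
  · subst h; rw [oneDown_self, mval_pred hd]
  · rw [oneDown_of_ne d h, mval_last, sub_zero]

end OneDown

section MagnonAction

variable [Fintype V] [DecidableEq V]

/-- The basis vector `e_μ`. -/
abbrev basisKet {d : ℕ} (μ : SConf V d) : SConf V d → ℂ := Pi.single μ 1

lemma Sz_mulVec_basisKet {d : ℕ} (u : V) (μ : SConf V d) :
    Sz d u *ᵥ basisKet μ = (mval d (μ u) : ℂ) • basisKet μ := by
  ext ν
  by_cases h : ν = μ <;> simp [Sz, basisKet, h]

lemma Sp_mulVec_basisKet {d : ℕ} (u : V) (μ : SConf V d) :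
    Sp d u *ᵥ basisKet μ = (raiseCoeff d (μ u) : ℂ) •
      basisKet (Function.update μ u ⟨min ((μ u : ℕ) + 1) d, by omega⟩) := by
  ext ν
  simp [Sp, basisKet, Pi.single_apply]

lemma Sm_mulVec_basisKet {d : ℕ} (u : V) (μ : SConf V d) :
    Sm d u *ᵥ basisKet μ = (lowerCoeff d (μ u) : ℂ) •
      basisKet (Function.update μ u ⟨(μ u : ℕ) - 1, by have := (μ u).isLt; omega⟩) := by
  ext ν
  simp [Sm, basisKet, Pi.single_apply]

lemma Sp_mulVec_basisKet_of_eq_last {d : ℕ} {u : V} {μ : SConf V d} (h : μ u = Fin.last d) :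
    Sp d u *ᵥ basisKet μ = 0 := by
  have hc : raiseCoeff d (μ u) = 0 := by rw [h, raiseCoeff_last]
  rw [Sp_mulVec_basisKet, hc, Complex.ofReal_zero, zero_smul]

lemma Sm_mulVec_basisKet_of_eq_last {d : ℕ} {u : V} {μ : SConf V d} (h : μ u = Fin.last d) :
    Sm d u *ᵥ basisKet μ =
      (Real.sqrt d : ℂ) • basisKet (Function.update μ u ⟨d - 1, by omega⟩) := by
  have hc : lowerCoeff d (μ u) = Real.sqrt d := by rw [h, lowerCoeff_last]
  rw [Sm_mulVec_basisKet, hc]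
  simp only [h, Fin.val_last]

lemma Sp_mulVec_basisKet_of_eq_pred {d : ℕ} (hd : 1 ≤ d) {u : V} {μ : SConf V d}
    (h : μ u = ⟨d - 1, by omega⟩) :
    Sp d u *ᵥ basisKet μ = (Real.sqrt d : ℂ) • basisKet (Function.update μ u (Fin.last d)) := by
  have hmin : min (d - 1 + 1) d = d := by omega
  have hc : raiseCoeff d (μ u) = Real.sqrt d := by rw [h, raiseCoeff_pred hd]
  rw [Sp_mulVec_basisKet, hc]
  simp only [h, hmin]
  rfl

lemma Sp_mulVec_Sm_mulVec_of_eq_last {d : ℕ} {u v : V} (huv : u ≠ v) {μ : SConf V d}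
    (h : μ u = Fin.last d) : Sp d u *ᵥ (Sm d v *ᵥ basisKet μ) = 0 := by
  rw [Sm_mulVec_basisKet, Matrix.mulVec_smul, Sp_mulVec_basisKet_of_eq_last, smul_zero]
  rwa [Function.update_of_ne huv]

lemma Sm_mulVec_fullUp (d : ℕ) (u : V) :
    Sm d u *ᵥ basisKet (fullUp V d) = (Real.sqrt d : ℂ) • basisKet (oneDown d u) :=
  Sm_mulVec_basisKet_of_eq_last rfl

lemma Sm_mulVec_Sp_mulVec_oneDown {d : ℕ} (hd : 1 ≤ d) (u v n : V) :
    Sm d u *ᵥ (Sp d v *ᵥ basisKet (oneDown d n)) =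
      if v = n then (d : ℂ) • basisKet (oneDown d u) else 0 := by
  split_ifs with h
  · subst h
    rw [Sp_mulVec_basisKet_of_eq_pred hd (oneDown_self d v), update_oneDown_self,
      Matrix.mulVec_smul, Sm_mulVec_fullUp, smul_smul, sqrt_cast_mul_self]
  · rw [Sp_mulVec_basisKet_of_eq_last (oneDown_of_ne d h), Matrix.mulVec_zero]

lemma Sp_mulVec_Sm_mulVec_oneDown {d : ℕ} (hd : 1 ≤ d) {u v : V} (huv : u ≠ v) (n : V) :
    Sp d u *ᵥ (Sm d v *ᵥ basisKet (oneDown d n)) =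
      if u = n then (d : ℂ) • basisKet (oneDown d v) else 0 := by
  split_ifs with h
  · subst h
    rw [Sm_mulVec_basisKet_of_eq_last (oneDown_of_ne d huv.symm), Matrix.mulVec_smul,
      Sp_mulVec_basisKet_of_eq_pred hd
        (by rw [Function.update_of_ne huv, oneDown_self]),
      smul_smul, sqrt_cast_mul_self, Function.update_comm huv.symm, update_oneDown_self]
    rfl
  · exact Sp_mulVec_Sm_mulVec_of_eq_last huv (oneDown_of_ne d h)

lemma Hs_mulVec (G : SimpleGraph V) [DecidableRel G.Adj] (d : ℕ) (ψ : SConf V d → ℂ) :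
    Hs G d *ᵥ ψ = (1 / 2 : ℂ) • ∑ u : V, ∑ v ∈ G.neighborFinset u,
      (Sz d u *ᵥ (Sz d v *ᵥ ψ) +
        (1 / 2 : ℂ) • (Sp d u *ᵥ (Sm d v *ᵥ ψ) + Sm d u *ᵥ (Sp d v *ᵥ ψ))) := by
  simp only [Hs, Matrix.smul_mulVec, Matrix.sum_mulVec, Matrix.add_mulVec, Matrix.mulVec_mulVec]

lemma Sz_mulVec_Sz_mulVec_basisKet {d : ℕ} (u v : V) (μ : SConf V d) :
    Sz d u *ᵥ (Sz d v *ᵥ basisKet μ) =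
      ((mval d (μ u) : ℂ) * (mval d (μ v) : ℂ)) • basisKet μ := by
  rw [Sz_mulVec_basisKet, Matrix.mulVec_smul, Sz_mulVec_basisKet, smul_smul, mul_comm]

lemma Hs_mulVec_fullUp {G : SimpleGraph V} [DecidableRel G.Adj] {j : ℕ}
    (hreg : G.IsRegularOfDegree j) (d : ℕ) :
    Hs G d *ᵥ basisKet (fullUp V d) =
      ((Fintype.card V : ℂ) * j / 2 * (sval d : ℂ) ^ 2) • basisKet (fullUp V d) := by
  have hpair (u : V) : ∀ v ∈ G.neighborFinset u,
      Sz d u *ᵥ (Sz d v *ᵥ basisKet (fullUp V d)) + (1 / 2 : ℂ) •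
        (Sp d u *ᵥ (Sm d v *ᵥ basisKet (fullUp V d)) +
          Sm d u *ᵥ (Sp d v *ᵥ basisKet (fullUp V d))) =
      ((sval d : ℂ) ^ 2) • basisKet (fullUp V d) := by
    intro v hv
    have huv : u ≠ v := ((G.mem_neighborFinset u v).1 hv).ne
    rw [Sz_mulVec_Sz_mulVec_basisKet, Sp_mulVec_Sm_mulVec_of_eq_last huv rfl,
      Sp_mulVec_basisKet_of_eq_last rfl, Matrix.mulVec_zero, add_zero, smul_zero, add_zero]
    simp only [fullUp, mval_last, sq]
  rw [Hs_mulVec, Finset.sum_congr rfl fun u _ => Finset.sum_congr rfl (hpair u)]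
  simp only [Finset.sum_const, SimpleGraph.card_neighborFinset_eq_degree, hreg.degree_eq,
    Finset.card_univ, ← Nat.cast_smul_eq_nsmul ℂ, smul_smul]
  congr 1
  ring

lemma Hs_mulVec_oneDown {G : SimpleGraph V} [DecidableRel G.Adj] {j : ℕ}
    (hreg : G.IsRegularOfDegree j) {d : ℕ} (hd : 1 ≤ d) (n : V) :
    Hs G d *ᵥ basisKet (oneDown d n) =
      ((Fintype.card V : ℂ) * j / 2 * (sval d : ℂ) ^ 2 - j * (sval d : ℂ)) •
          basisKet (oneDown d n) +
        (sval d : ℂ) • ∑ v ∈ G.neighborFinset n, basisKet (oneDown d v) := by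
  set e : V → SConf V d → ℂ := fun v => basisKet (oneDown d v) with he
  have hpair (u : V) : ∀ v ∈ G.neighborFinset u,
      Sz d u *ᵥ (Sz d v *ᵥ basisKet (oneDown d n)) + (1 / 2 : ℂ) •
        (Sp d u *ᵥ (Sm d v *ᵥ basisKet (oneDown d n)) +
          Sm d u *ᵥ (Sp d v *ᵥ basisKet (oneDown d n))) =
      (if u = n then -(sval d : ℂ) • e n + (sval d : ℂ) • e v else 0) +
        ((sval d : ℂ) ^ 2) • e n +
        (if v = n then -(sval d : ℂ) • e n + (sval d : ℂ) • e u else 0) := by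
    intro v hv
    have huv : u ≠ v := ((G.mem_neighborFinset u v).1 hv).ne
    rw [Sz_mulVec_Sz_mulVec_basisKet, Sp_mulVec_Sm_mulVec_oneDown hd huv,
      Sm_mulVec_Sp_mulVec_oneDown hd, mval_oneDown hd, mval_oneDown hd]
    have hs : (d : ℂ) = 2 * (sval d : ℂ) := by simp [sval]; ring
    rw [hs]
    by_cases hu : u = n
    · have hv' : v ≠ n := fun h => huv (hu.trans h.symm)
      simp only [hu, hv', if_true, if_false, he]
      push_cast
      module
    · by_cases hv' : v = n
      · simp only [hu, hv', if_true, if_false, he]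
        push_cast
        module
      · simp only [hu, hv', if_false, he]
        push_cast
        module
  have hleft : ∑ u : V, ∑ v ∈ G.neighborFinset u,
      (if u = n then -(sval d : ℂ) • e n + (sval d : ℂ) • e v else 0) =
      -((j : ℂ) * (sval d : ℂ)) • e n + (sval d : ℂ) • ∑ v ∈ G.neighborFinset n, e v := by
    rw [Finset.sum_eq_single n (fun u _ hu => by simp [hu]) (by simp)]
    simp only [if_true, Finset.sum_add_distrib, Finset.sum_const, ← Finset.smul_sum,
      SimpleGraph.card_neighborFinset_eq_degree, hreg.degree_eq, ← Nat.cast_smul_eq_nsmul ℂ,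
      smul_smul, mul_neg]
  have hright : ∑ u : V, ∑ v ∈ G.neighborFinset u,
      (if v = n then -(sval d : ℂ) • e n + (sval d : ℂ) • e u else 0) =
      ∑ u : V, ∑ v ∈ G.neighborFinset u,
      (if u = n then -(sval d : ℂ) • e n + (sval d : ℂ) • e v else 0) :=
    Finset.sum_comm' (by simp [G.adj_comm])
  rw [Hs_mulVec, Finset.sum_congr rfl fun u _ => Finset.sum_congr rfl (hpair u)]
  simp only [Finset.sum_add_distrib]
  rw [hright, hleft]
  simp only [Finset.sum_const, SimpleGraph.card_neighborFinset_eq_degree, hreg.degree_eq,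
    Finset.card_univ, ← Nat.cast_smul_eq_nsmul ℂ, smul_smul]
  module

lemma Hs_mulVec_sum_oneDown {G : SimpleGraph V} [DecidableRel G.Adj] {j : ℕ}
    (hreg : G.IsRegularOfDegree j) {d : ℕ} (hd : 1 ≤ d) (x : V → ℂ) :
    Hs G d *ᵥ (∑ n, x n • basisKet (oneDown d n)) =
      ∑ n, (((Fintype.card V : ℂ) * j / 2 * (sval d : ℂ) ^ 2 - j * (sval d : ℂ)) • x +
        (sval d : ℂ) • (G.adjMatrix ℂ *ᵥ x)) n • basisKet (oneDown d n) := by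
  simp only [Matrix.mulVec_sum, Matrix.mulVec_smul, Hs_mulVec_oneDown hreg hd, smul_add,
    Finset.sum_add_distrib, Pi.add_apply, Pi.smul_apply, add_smul, smul_eq_mul]
  congr 1
  · simp only [smul_smul, mul_comm]
  · simp only [smul_comm _ (sval d : ℂ), mul_smul, ← Finset.smul_sum]
    rw [sum_smul_sum_neighborFinset]

lemma sum_smul_basisKet_oneDown_apply {d : ℕ} (hd : 1 ≤ d) (x : V → ℂ) (m : V) :
    (∑ n, x n • basisKet (oneDown d n)) (oneDown d m) = x m := by
  simp [basisKet, Finset.sum_apply, Pi.single_apply, (oneDown_injective hd).eq_iff]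

/-- The restriction of `H_s` to the one-magnon sector is `(Njs²/2 − js)·1 + s·Adj(G)`. -/
lemma oneMagnonBlock_mulVec {G : SimpleGraph V} [DecidableRel G.Adj] {j : ℕ}
    (hreg : G.IsRegularOfDegree j) {d : ℕ} (hd : 1 ≤ d) (x : V → ℂ) :
    (Matrix.of fun m n : V => Hs G d (oneDown d m) (oneDown d n)) *ᵥ x =
      ((Fintype.card V : ℂ) * j / 2 * (sval d : ℂ) ^ 2 - j * (sval d : ℂ)) • x +
        (sval d : ℂ) • (G.adjMatrix ℂ *ᵥ x) := by
  ext m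
  rw [← sum_smul_basisKet_oneDown_apply hd (_ + _) m, ← Hs_mulVec_sum_oneDown hreg hd]
  simp only [Matrix.mulVec_sum, Matrix.mulVec_smul, basisKet, Matrix.mulVec_single_one,
    Finset.sum_apply, Pi.smul_apply, Matrix.col_apply, smul_eq_mul]
  simp only [Matrix.mulVec, dotProduct, Matrix.of_apply, mul_comm]

end MagnonAction

/-- (One-magnon spectrum for general spin `s = d/2`, Eq. (5.1)) The fully polarized state is an
eigenvector of `H_s` with eigenvalue `(1/2)·N·j·s²`; each adjacency eigenvector `x` with
`Adj(G)x = λx` yields a one-magnon eigenstate with eigenvalue `(1/2)·N·j·s² + (λ − j)·s`; and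
the eigenvalues of `H_s` on the one-magnon sector are exactly these numbers. -/
theorem one_magnon_spectrum_spin_s [Fintype V] [DecidableEq V]
    (G : SimpleGraph V) [DecidableRel G.Adj] (N j : ℕ)
    (hN : Fintype.card V = N) (hreg : G.IsRegularOfDegree j)
    (d : ℕ) (hd : 1 ≤ d) :
    Hs G d *ᵥ (Pi.single (fullUp V d) 1 : SConf V d → ℂ)
        = ((((N : ℝ) * j / 2) * sval d ^ 2 : ℝ) : ℂ) • (Pi.single (fullUp V d) 1 : SConf V d → ℂ)
    ∧ (∀ (lam : ℝ) (x : V → ℂ), G.adjMatrix ℂ *ᵥ x = (lam : ℂ) • x →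
        Hs G d *ᵥ (∑ n : V, x n • (Pi.single (oneDown d n) 1 : SConf V d → ℂ))
          = ((((N : ℝ) * j / 2) * sval d ^ 2 + (lam - (j : ℝ)) * sval d : ℝ) : ℂ) •
              (∑ n : V, x n • (Pi.single (oneDown d n) 1 : SConf V d → ℂ)))
    ∧ (∀ E : ℝ,
        (∃ ψ : V → ℂ, ψ ≠ 0 ∧
          (Matrix.of fun m n : V => Hs G d (oneDown d m) (oneDown d n)) *ᵥ ψ = (E : ℂ) • ψ)
        ↔ ∃ lam : ℝ, (∃ x : V → ℂ, x ≠ 0 ∧ G.adjMatrix ℂ *ᵥ x = (lam : ℂ) • x)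
            ∧ E = ((N : ℝ) * j / 2) * sval d ^ 2 + (lam - (j : ℝ)) * sval d) := by
  subst hN
  have hs : (sval d : ℂ) ≠ 0 := by
    have : d ≠ 0 := by omega
    simp [sval, this]
  refine ⟨?_, fun lam x hx => ?_, fun E => ⟨?_, ?_⟩⟩
  · rw [Hs_mulVec_fullUp hreg]
    push_cast
    rfl
  · rw [Hs_mulVec_sum_oneDown hreg hd, hx, Finset.smul_sum]
    refine Finset.sum_congr rfl fun n _ => ?_
    simp only [Pi.add_apply, Pi.smul_apply, smul_smul, smul_eq_mul]
    congr 1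
    push_cast
    ring
  · rintro ⟨x, hx0, hx⟩
    have hsr : sval d ≠ 0 := by exact_mod_cast hs
    refine ⟨(E - (Fintype.card V * j / 2) * sval d ^ 2) / sval d + j, ⟨x, hx0, ?_⟩, ?_⟩
    · rw [oneMagnonBlock_mulVec hreg hd] at hx
      ext n
      have hn := congrFun hx n
      simp only [Pi.add_apply, Pi.smul_apply, smul_eq_mul] at hn ⊢
      push_cast
      field_simp
      linear_combination 2 * hn
    · field_simp
      ring
  · rintro ⟨lam, ⟨x, hx0, hx⟩, rfl⟩
    refine ⟨x, hx0, ?_⟩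
    rw [oneMagnonBlock_mulVec hreg hd, hx]
    push_cast
    module
end

section
/- (Bounding line restated via total magnon number) Let E₀ = N·j/8 be the energy of the fully polarized state and E₁ the smallest eigenvalue of H on the one-magnon sector. Then for every a with 0 ≤ a ≤ N and every nonzero vector ψ in the a-magnon sector ℋ_a, the Rayleigh quotient satisfies ⟨ψ, H ψ⟩ / ‖ψ‖² ≥ E₀ + a·(E₁ − E₀); i.e. every point (a, E_a) of the graph of minimal sector energies lies on or above the line connecting (0, E₀) and (1, E₁). -/
open Matrix BigOperators
open scoped ComplexOrder

/-- Spin-1/2 configurations: `true` means spin down. -/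
abbrev Conf (V : Type*) := V → Bool

variable {V : Type*}

/-- The operator `P_{uv}` interchanging the spin values at sites `u` and `v`. -/
noncomputable def swapOp [Fintype V] [DecidableEq V] (u v : V) :
    Matrix (Conf V) (Conf V) ℂ :=
  Matrix.of fun σ τ => if τ = σ ∘ (Equiv.swap u v) then 1 else 0

lemma swapOp_comm [Fintype V] [DecidableEq V] (u v : V) :
    swapOp (V := V) u v = swapOp v u := by
  unfold swapOp
  rw [Equiv.swap_comm]

/-- The spin-1/2 Heisenberg Hamiltonian `H = Σ_{{u,v} ∈ E(G)} ((1/2)·P_{uv} − (1/4)·Id)`. -/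
noncomputable def Ham [Fintype V] [DecidableEq V] (G : SimpleGraph V) [DecidableRel G.Adj] :
    Matrix (Conf V) (Conf V) ℂ :=
  ∑ e ∈ G.edgeFinset,
    Sym2.lift ⟨fun u v => (1/2 : ℂ) • swapOp u v - (1/4 : ℂ) • 1,
      fun u v => by dsimp only; rw [swapOp_comm]⟩ e

/-- The configuration `σ_n` whose single down spin is at `n`. -/
def singleDown [DecidableEq V] (n : V) : Conf V := fun w => decide (w = n)

/-- The one-magnon block `H₁` of `H`, as a matrix indexed by `V`
(via the identification `e_{σ_n} ↦ e_n`). -/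
noncomputable def H1 [Fintype V] [DecidableEq V] (G : SimpleGraph V) [DecidableRel G.Adj] :
    Matrix V V ℂ :=
  Matrix.of fun m n => Ham G (singleDown m) (singleDown n)

/-- Number of down spins `|A_σ|` of a configuration. -/
def downCard [Fintype V] (σ : Conf V) : ℕ := (Finset.univ.filter fun u => σ u = true).card

/-- `e(A_σ, V∖A_σ)`: the number of edges joining the down-set to its complement. -/
noncomputable def crossCount (G : SimpleGraph V) (σ : Conf V) : ℕ :=
  {e : Sym2 V | e ∈ G.edgeSet ∧ ∃ u v : V, σ u = true ∧ σ v = false ∧ e = s(u, v)}.ncard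

/-- `e(A_σ)`: the number of edges with both endpoints in the down-set. -/
noncomputable def inCount (G : SimpleGraph V) (σ : Conf V) : ℕ :=
  {e : Sym2 V | e ∈ G.edgeSet ∧ ∀ u ∈ e, σ u = true}.ncard

/-- The transposition of the two endpoints of `e`. -/
def endSwap [DecidableEq V] (e : Sym2 V) : Equiv.Perm V :=
  Sym2.lift ⟨fun u v => Equiv.swap u v, fun u v => Equiv.swap_comm u v⟩ e

lemma endSwap_involutive [DecidableEq V] (e : Sym2 V) : Function.Involutive (endSwap e) := by
  induction e with
  | _ u v => exact fun w => Equiv.swap_apply_self u v w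

lemma comp_endSwap_involutive [DecidableEq V] (e : Sym2 V) :
    Function.Involutive fun σ : Conf V => σ ∘ endSwap e := by
  intro σ
  funext w
  simp [endSwap_involutive e w]

lemma singleDown_injective [DecidableEq V] : Function.Injective (singleDown (V := V)) := by
  intro m n h
  simpa [singleDown] using congrFun h m

lemma singleDown_comp_endSwap [DecidableEq V] (e : Sym2 V) (m : V) :
    singleDown m ∘ endSwap e = singleDown (endSwap e m) := by
  funext w
  simp only [singleDown, Function.comp_apply, decide_eq_decide]
  exact (endSwap_involutive e).eq_iff

/-- The matrix `Σ_{e ∈ S} (Q_e / 2 - 1 / 4)`, where `(Q_e x)(i) = x (q e i)`. -/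
noncomputable def exchangeMatrix {ι κ : Type*} [DecidableEq ι] (S : Finset κ) (q : κ → ι → ι) :
    Matrix ι ι ℂ :=
  Matrix.of fun i k =>
    ∑ e ∈ S, ((1 / 2 : ℂ) * (if k = q e i then 1 else 0) - (1 / 4 : ℂ) * (if i = k then 1 else 0))

lemma exchangeMatrix_isHermitian {ι κ : Type*} [DecidableEq ι] (S : Finset κ) (q : κ → ι → ι)
    (hq : ∀ e, Function.Involutive (q e)) : (exchangeMatrix S q).IsHermitian := by
  ext i k
  simp only [exchangeMatrix, conjTranspose_apply, of_apply, star_sum]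
  refine Finset.sum_congr rfl fun e _ => ?_
  have h : i = q e k ↔ k = q e i := by
    rw [eq_comm, (hq e).eq_iff]
  simp only [h, eq_comm (a := k) (b := i)]
  split_ifs <;> simp

lemma sum_normSq_sub_involutive {ι : Type*} [Fintype ι] (q : ι → ι)
    (hq : Function.Involutive q) (x : ι → ℂ) :
    ((∑ i, Complex.normSq (x i - x (q i)) : ℝ) : ℂ) =
      2 * ∑ i, (Complex.normSq (x i) : ℂ) - 2 * ∑ i, star (x i) * x (q i) := by
  have h1 : ∑ i, (Complex.normSq (x (q i)) : ℂ) = ∑ i, (Complex.normSq (x i) : ℂ) :=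
    Equiv.sum_comp hq.toPerm fun i => (Complex.normSq (x i) : ℂ)
  have h2 : ∑ i, star (x (q i)) * x i = ∑ i, star (x i) * x (q i) := by
    rw [← Equiv.sum_comp hq.toPerm fun i => star (x i) * x (q i)]
    simp [hq _]
  have h3 : ∀ i, (Complex.normSq (x i - x (q i)) : ℂ) =
      (Complex.normSq (x i) : ℂ) + Complex.normSq (x (q i)) - star (x i) * x (q i)
        - star (x (q i)) * x i := by
    intro i
    simp only [Complex.normSq_eq_conj_mul_self, map_sub, starRingEnd_apply]
    ring
  push_cast
  simp only [h3, Finset.sum_sub_distrib, Finset.sum_add_distrib, h1, h2]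
  ring

lemma star_dotProduct_self_eq {ι : Type*} [Fintype ι] (x : ι → ℂ) :
    star x ⬝ᵥ x = ((∑ i, Complex.normSq (x i) : ℝ) : ℂ) := by
  simp [dotProduct, Complex.normSq_eq_conj_mul_self]

lemma exchangeMatrix_form {ι κ : Type*} [Fintype ι] [DecidableEq ι] (S : Finset κ)
    (q : κ → ι → ι) (hq : ∀ e, Function.Involutive (q e)) (x : ι → ℂ) :
    star x ⬝ᵥ (exchangeMatrix S q *ᵥ x) =
      (((S.card : ℝ) / 4 * ∑ i, Complex.normSq (x i)
        - 1 / 4 * ∑ e ∈ S, ∑ i, Complex.normSq (x i - x (q e i)) : ℝ) : ℂ) := by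
  have h1 : ∀ i, (exchangeMatrix S q *ᵥ x) i =
      ∑ e ∈ S, ((1 / 2 : ℂ) * x (q e i) - (1 / 4 : ℂ) * x i) := by
    intro i
    simp only [exchangeMatrix, mulVec, dotProduct, of_apply, Finset.sum_mul]
    rw [Finset.sum_comm]
    refine Finset.sum_congr rfl fun e _ => ?_
    simp [sub_mul, Finset.sum_sub_distrib]
  have h2 : star x ⬝ᵥ (exchangeMatrix S q *ᵥ x) =
      ∑ e ∈ S, ((1 / 2 : ℂ) * ∑ i, star (x i) * x (q e i)
        - (1 / 4 : ℂ) * ∑ i, (Complex.normSq (x i) : ℂ)) := by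
    simp only [dotProduct, h1, Finset.mul_sum, Pi.star_apply]
    rw [Finset.sum_comm]
    refine Finset.sum_congr rfl fun e _ => ?_
    rw [← Finset.sum_sub_distrib]
    refine Finset.sum_congr rfl fun i _ => ?_
    rw [Complex.normSq_eq_conj_mul_self, starRingEnd_apply]
    ring
  have h3 : ∀ e, ((1 / 2 : ℂ) * ∑ i, star (x i) * x (q e i)
        - (1 / 4 : ℂ) * ∑ i, (Complex.normSq (x i) : ℂ)) =
      1 / 4 * ∑ i, (Complex.normSq (x i) : ℂ)
        - 1 / 4 * ((∑ i, Complex.normSq (x i - x (q e i)) : ℝ) : ℂ) := by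
    intro e
    rw [sum_normSq_sub_involutive _ (hq e)]
    ring
  rw [h2]
  simp only [h3, Finset.sum_sub_distrib, Finset.sum_const, nsmul_eq_mul, ← Finset.mul_sum]
  push_cast
  ring

lemma Ham_eq_exchangeMatrix [Fintype V] [DecidableEq V] (G : SimpleGraph V)
    [DecidableRel G.Adj] :
    Ham G = exchangeMatrix G.edgeFinset fun e (σ : Conf V) => σ ∘ endSwap e := by
  ext σ τ
  simp only [Ham, exchangeMatrix, Matrix.sum_apply, of_apply]
  refine Finset.sum_congr rfl fun e _ => ?_
  induction e with
  | _ u v =>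
    simp only [swapOp, endSwap, Sym2.lift_mk, Matrix.sub_apply, Matrix.smul_apply, of_apply,
      Matrix.one_apply, smul_eq_mul]
    congr

lemma H1_eq_exchangeMatrix [Fintype V] [DecidableEq V] (G : SimpleGraph V)
    [DecidableRel G.Adj] :
    H1 G = exchangeMatrix G.edgeFinset fun e => endSwap e := by
  ext m n
  simp only [H1, Ham_eq_exchangeMatrix, exchangeMatrix, of_apply, singleDown_comp_endSwap,
    singleDown_injective.eq_iff]

/-- The least eigenvalue of a Hermitian matrix bounds its quadratic form from below. -/
lemma Matrix.IsHermitian.least_eigenvalue_mul_le {ι : Type*} [Fintype ι] [DecidableEq ι]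
    {A : Matrix ι ι ℂ} (hA : A.IsHermitian) {c : ℝ}
    (hc : c ∈ lowerBounds {E : ℝ | ∃ x : ι → ℂ, x ≠ 0 ∧ A *ᵥ x = (E : ℂ) • x}) (x : ι → ℂ) :
    (c : ℂ) * (star x ⬝ᵥ x) ≤ star x ⬝ᵥ (A *ᵥ x) := by
  have hB : (A - (c : ℂ) • 1).IsHermitian := by
    refine hA.sub ?_
    simp [IsHermitian, conjTranspose_smul]
  have hpos : (A - (c : ℂ) • 1).PosSemidef := by
    refine hB.posSemidef_iff_eigenvalues_nonneg.mpr fun i => ?_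
    have h := hB.mulVec_eigenvectorBasis i
    have hmem : hB.eigenvalues i + c ∈
        {E : ℝ | ∃ x : ι → ℂ, x ≠ 0 ∧ A *ᵥ x = (E : ℂ) • x} := by
      refine ⟨hB.eigenvectorBasis i, fun h0 => ?_, ?_⟩
      · exact hB.eigenvectorBasis.orthonormal.ne_zero i (by ext k; exact congrFun h0 k)
      · rw [sub_mulVec, smul_mulVec, one_mulVec, sub_eq_iff_eq_add] at h
        rw [h]
        push_cast
        rw [add_smul]
        rfl
    have := hc hmem
    simp only [Pi.zero_apply]
    linarith
  have := hpos.dotProduct_mulVec_nonneg x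
  rw [sub_mulVec, smul_mulVec, one_mulVec, dotProduct_sub, dotProduct_smul, smul_eq_mul] at this
  exact sub_nonneg.mp this

/-- The one-magnon amplitude obtained from `ψ` by adding one down spin to `τ`. -/
def addMagnon [DecidableEq V] (ψ : Conf V → ℂ) (τ : Conf V) (m : V) : ℂ :=
  if τ m = false then ψ (Function.update τ m true) else 0

/-- Reversal of the spin at `m`. -/
def flipAt [DecidableEq V] (m : V) (σ : Conf V) : Conf V := Function.update σ m (!σ m)

lemma flipAt_involutive [DecidableEq V] (m : V) :
    Function.Involutive (flipAt m) := by
  intro σ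
  simp [flipAt]

lemma sum_sum_flipAt [Fintype V] [DecidableEq V] (F : Conf V → V → ℝ) :
    ∑ τ, ∑ m, F τ m = ∑ σ, ∑ m, F (flipAt m σ) m := by
  rw [Finset.sum_comm, Finset.sum_comm (s := (Finset.univ : Finset (Conf V)))]
  exact Finset.sum_congr rfl fun m _ =>
    (Equiv.sum_comp (flipAt_involutive m).toPerm fun τ => F τ m).symm

lemma addMagnon_flipAt_self [DecidableEq V] (ψ : Conf V → ℂ) (σ : Conf V) (m : V) :
    addMagnon ψ (flipAt m σ) m = if σ m = true then ψ σ else 0 := by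
  by_cases h : σ m = true
  · have hσ : Function.update σ m true = σ := by rw [← h, Function.update_eq_self]
    simp [addMagnon, flipAt, h, hσ]
  · simp [addMagnon, flipAt, h]

lemma addMagnon_flipAt_swap [DecidableEq V] (ψ : Conf V → ℂ) (σ : Conf V) {u v : V}
    (hu : σ u = true) (hv : σ v = false) :
    addMagnon ψ (flipAt u σ) v = ψ (σ ∘ Equiv.swap u v) := by
  have huv : v ≠ u := by rintro rfl; simp_all
  simp only [addMagnon, flipAt, Function.update_of_ne huv, hv, if_true, hu]
  congr 1
  funext w
  by_cases h1 : w = u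
  · subst h1
    simp [Function.update_of_ne huv.symm, hv]
  by_cases h2 : w = v
  · subst h2
    simp [hu]
  · simp [h1, h2, Equiv.swap_apply_of_ne_of_ne h1 h2]

lemma sum_normSq_addMagnon [Fintype V] [DecidableEq V] (ψ : Conf V → ℂ) (a : ℕ)
    (hsec : ∀ σ : Conf V, ψ σ ≠ 0 → downCard σ = a) :
    ∑ τ, ∑ m, Complex.normSq (addMagnon ψ τ m) = a * ∑ σ, Complex.normSq (ψ σ) := by
  rw [sum_sum_flipAt fun τ m => Complex.normSq (addMagnon ψ τ m), Finset.mul_sum]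
  refine Finset.sum_congr rfl fun σ _ => ?_
  simp only [addMagnon_flipAt_self, apply_ite Complex.normSq, map_zero]
  rw [← Finset.sum_filter, Finset.sum_const, nsmul_eq_mul]
  by_cases h : ψ σ = 0
  · simp [h]
  · rw [← hsec σ h, downCard]

lemma sum_normSq_sub_le_addMagnon [Fintype V] [DecidableEq V] (ψ : Conf V → ℂ) (e : Sym2 V) :
    ∑ σ, Complex.normSq (ψ σ - ψ (σ ∘ endSwap e)) ≤
      ∑ τ, ∑ m, Complex.normSq (addMagnon ψ τ m - addMagnon ψ τ (endSwap e m)) := by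
  rw [sum_sum_flipAt fun τ m => Complex.normSq (addMagnon ψ τ m - addMagnon ψ τ (endSwap e m))]
  refine Finset.sum_le_sum fun σ _ => ?_
  have key : ∀ u v : V, endSwap e = Equiv.swap u v → σ u = true → σ v = false →
      Complex.normSq (ψ σ - ψ (σ ∘ endSwap e)) ≤ ∑ m, Complex.normSq
        (addMagnon ψ (flipAt m σ) m - addMagnon ψ (flipAt m σ) (endSwap e m)) := by
    intro u v he hu hv
    refine le_trans (le_of_eq ?_) (Finset.single_le_sum
      (fun m _ => Complex.normSq_nonneg _) (Finset.mem_univ u))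
    rw [addMagnon_flipAt_self, if_pos hu, he, Equiv.swap_apply_left,
      addMagnon_flipAt_swap ψ σ hu hv]
  induction e with
  | _ u v =>
    have he : endSwap s(u, v) = Equiv.swap u v := rfl
    cases hu : σ u <;> cases hv : σ v
    · have : σ ∘ endSwap s(u, v) = σ := by
        funext w
        rw [he, Function.comp_apply, Equiv.swap_apply_def]
        split_ifs <;> simp_all
      rw [this, sub_self, map_zero]
      exact Finset.sum_nonneg fun m _ => Complex.normSq_nonneg _
    · exact key v u (he.trans (Equiv.swap_comm u v)) hv hu
    · exact key u v he hu hv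
    · have : σ ∘ endSwap s(u, v) = σ := by
        funext w
        rw [he, Function.comp_apply, Equiv.swap_apply_def]
        split_ifs <;> simp_all
      rw [this, sub_self, map_zero]
      exact Finset.sum_nonneg fun m _ => Complex.normSq_nonneg _

/-- (Bounding line restated via total magnon number) With `E₀ = N·j/8` and `E₁` the smallest
one-magnon eigenvalue, every nonzero `ψ` in the `a`-magnon sector satisfies
`⟨ψ, H ψ⟩ ≥ (E₀ + a·(E₁ − E₀))·‖ψ‖²`. -/
theorem bounding_line_rayleigh [Fintype V] [DecidableEq V]
    (G : SimpleGraph V) [DecidableRel G.Adj] (N j : ℕ)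
    (hN : Fintype.card V = N) (hreg : G.IsRegularOfDegree j)
    (E1 : ℝ)
    (hE1 : IsLeast {E : ℝ | ∃ x : V → ℂ, x ≠ 0 ∧ H1 G *ᵥ x = (E : ℂ) • x} E1)
    (a : ℕ) (haN : a ≤ N)
    (ψ : Conf V → ℂ) (hψ : ψ ≠ 0) (hsec : ∀ σ : Conf V, ψ σ ≠ 0 → downCard σ = a) :
    ((((N : ℝ) * j / 8) + a * (E1 - (N : ℝ) * j / 8) : ℝ) : ℂ) * (star ψ ⬝ᵥ ψ)
      ≤ star ψ ⬝ᵥ (Ham G *ᵥ ψ) := by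
  have hL : (G.edgeFinset.card : ℝ) / 4 = (N : ℝ) * j / 8 := by
    have h := G.sum_degrees_eq_twice_card_edges
    simp only [hreg.degree_eq, Finset.sum_const, Finset.card_univ, hN, smul_eq_mul] at h
    have h' : (N : ℝ) * j = 2 * G.edgeFinset.card := by exact_mod_cast h
    linarith
  have hone : ∀ x : V → ℂ, E1 * ∑ m, Complex.normSq (x m) ≤
      (N : ℝ) * j / 8 * ∑ m, Complex.normSq (x m)
        - 1 / 4 * ∑ e ∈ G.edgeFinset, ∑ m, Complex.normSq (x m - x (endSwap e m)) := by
    intro x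
    have hH : (H1 G).IsHermitian := by
      rw [H1_eq_exchangeMatrix]
      exact exchangeMatrix_isHermitian _ _ endSwap_involutive
    have h := hH.least_eigenvalue_mul_le hE1.2 x
    rw [H1_eq_exchangeMatrix, exchangeMatrix_form _ _ endSwap_involutive,
      star_dotProduct_self_eq, hL] at h
    exact_mod_cast h
  have hsum := Finset.sum_le_sum fun τ (_ : τ ∈ Finset.univ) => hone (addMagnon ψ τ)
  rw [Finset.sum_sub_distrib, ← Finset.mul_sum, ← Finset.mul_sum, ← Finset.mul_sum,
    sum_normSq_addMagnon ψ a hsec, Finset.sum_comm] at hsum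
  have hedge := Finset.sum_le_sum fun e (_ : e ∈ G.edgeFinset) =>
    sum_normSq_sub_le_addMagnon ψ e
  rw [Ham_eq_exchangeMatrix, exchangeMatrix_form _ _ comp_endSwap_involutive,
    star_dotProduct_self_eq, hL, ← Complex.ofReal_mul, Complex.real_le_real]
  linarith
end
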